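/- Monotonicity of the worst-case wasted execution: let n ≥ 1 and C, C', Q, Q' : {0,…,n−1} → ℝ with C(i) > 0, C'(i) > 0, 0 ≤ Q(i) ≤ C(i), 0 ≤ Q'(i) ≤ C'(i). Define W by W(0) = C(0), W(i+1) = C(i+1) + max(0, W(i) − Q(i+1)), and W' analogously from C', Q'. If C'(i) ≤ C(i) and Q(i) ≤ Q'(i) for all i, then W'(i) ≤ W(i) for all i. In particular, enlarging any non-preemptive ending interval never increases the worst-case wasted execution. -/

import Mathlib

/-- Monotonicity of the worst-case wasted execution: decreasing the execution
times and enlarging the non-preemptive ending intervals never increases the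
worst-case wasted execution `W(0) = C(0)`,
`W(i+1) = C(i+1) + max(0, W(i) − Q(i+1))`. -/
theorem wcwe_monotone
    (n : ℕ) (hn : 1 ≤ n) (C C' Q Q' W W' : ℕ → ℝ)
    (hC : ∀ i < n, 0 < C i) (hC' : ∀ i < n, 0 < C' i)
    (hQ : ∀ i < n, 0 ≤ Q i ∧ Q i ≤ C i)
    (hQ' : ∀ i < n, 0 ≤ Q' i ∧ Q' i ≤ C' i)
    (hW0 : W 0 = C 0)
    (hWsucc : ∀ i, i + 1 < n → W (i + 1) = C (i + 1) + max 0 (W i - Q (i + 1)))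
    (hW'0 : W' 0 = C' 0)
    (hW'succ : ∀ i, i + 1 < n → W' (i + 1) = C' (i + 1) + max 0 (W' i - Q' (i + 1)))
    (hCC' : ∀ i < n, C' i ≤ C i)
    (hQQ' : ∀ i < n, Q i ≤ Q' i) :
    ∀ i < n, W' i ≤ W i := by
  intro i
  induction i with
  | zero =>
    intro h
    rw [hW0, hW'0]
    exact hCC' 0 h
  | succ k ih =>
    intro h
    rw [hWsucc k h, hW'succ k h]
    exact add_le_add (hCC' _ h)
      (max_le_max_left 0 (sub_le_sub (ih (Nat.lt_of_succ_lt h)) (hQQ' _ h)))
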